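/- Let λ₋ < 2 < λ₊, r > 0, and let a, b, c, d be real with b > 0, c > 0; define Λ(s) = λ₋ + (λ₊ − λ₋)(tanh(s) + 1)/2 and M₂(x) = a + b·sech(c(x − d)). Let X_l(λ) (for λ < 2) denote the unique real root of 3x − x³ + λ = 0 with x < −1 and X_u(λ) (for λ > −2) the unique real root with x > 1. Set M₋ = M₂(X_l(λ₋)) and M₊ = M₂(X_u(λ₊)), and suppose M₋ < 2, −2 < M₊ < 2, X_l(λ₋) < d < X_u(λ₊), and a + b > 2. For ε > 0 let (x, y_ε) : ℝ → ℝ² be the solution of x′(t) = 3x(t) − x(t)³ + Λ(rt), ε y_ε′(t) = 3y_ε(t) − y_ε(t)³ + M₂(x(t)) with (x(t), y_ε(t)) → (X_l(λ₋), X_l(M₋)) as t → −∞. Then there exists ε₀ > 0 such that for all 0 < ε < ε₀ one has y_ε(t) → X_u(M₊) as t → +∞ (downstream B-tipping), and there exists ε₁ > 0 such that for all ε > ε₁ one has y_ε(t) → X_l(M₊) as t → +∞ (downstream end-point tracking). -/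

import Mathlib

open Filter

/-- A differentiable function starting below a line stays below it if it grows more slowly than the
line at every contact. -/
lemma le_affine {u : ℝ → ℝ} (hu : Differentiable ℝ u) {s e k m : ℝ} (hs : u s ≤ k)
    (h : ∀ t, s ≤ t → t < e → u t = k + m * (t - s) → deriv u t < m)
    {t : ℝ} (hst : s ≤ t) (hte : t ≤ e) : u t ≤ k + m * (t - s) := by
  refine image_le_of_deriv_right_lt_deriv_boundary (f := u) (f' := deriv u) (a := s) (b := e)
    (B := fun t => k + m * (t - s)) (B' := fun _ => m) hu.continuous.continuousOn
    (fun t _ => (hu t).hasDerivAt.hasDerivWithinAt) (by simpa using hs) (fun t => ?_)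
    (fun t ht => h t ht.1 ht.2) ⟨hst, hte⟩
  simpa using (((hasDerivAt_id t).sub_const s).const_mul m).const_add k

lemma le_of_deriv_neg_of_eq {u : ℝ → ℝ} (hu : Differentiable ℝ u) {s k : ℝ} (hs : u s ≤ k)
    (h : ∀ t, s ≤ t → u t = k → deriv u t < 0) {t : ℝ} (hst : s ≤ t) : u t ≤ k := by
  simpa using le_affine hu (e := t) (m := 0) hs
    (fun t' h1 _ h3 => h t' h1 (by simpa using h3)) hst le_rfl

lemma le_of_tendsto_atBot_of_deriv_neg_of_eq {u : ℝ → ℝ} (hu : Differentiable ℝ u) {l k T : ℝ}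
    (hl : Tendsto u atBot (nhds l)) (hlk : l < k)
    (h : ∀ t, t ≤ T → u t = k → deriv u t < 0) : u T ≤ k := by
  obtain ⟨s, hs, hsT⟩ := ((hl.eventually_lt_const hlk).and (eventually_le_atBot T)).exists
  simpa using le_affine hu (e := T) (m := 0) hs.le
    (fun t' _ h2 h3 => h t' h2.le (by simpa using h3)) hsT le_rfl

lemma eventually_le_of_deriv_le_neg {u : ℝ → ℝ} (hu : Differentiable ℝ u) {k κ : ℝ} (hκ : 0 < κ)
    (h : ∀ᶠ t in atTop, k ≤ u t → deriv u t ≤ -κ) : ∀ᶠ t in atTop, u t ≤ k := by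
  obtain ⟨T, hT⟩ := eventually_atTop.1 h
  obtain ⟨s, hsT, hs⟩ : ∃ s, T ≤ s ∧ u s ≤ k := by
    by_contra! hcon
    have hpos : 0 < (u T - k) / (κ / 2) := div_pos (by linarith [hcon T le_rfl]) (by linarith)
    have hle := le_affine hu (s := T) (e := T + (u T - k) / (κ / 2)) (m := -(κ / 2)) le_rfl
      (fun t h1 _ _ => by linarith [hT t h1 (hcon t h1).le])
      (t := T + (u T - k) / (κ / 2)) (by linarith) le_rfl
    have heq : -(κ / 2) * (T + (u T - k) / (κ / 2) - T) = -(u T - k) := by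
      field_simp
      ring
    linarith [hcon (T + (u T - k) / (κ / 2)) (by linarith)]
  filter_upwards [eventually_ge_atTop s] with t ht
  exact le_of_deriv_neg_of_eq hu hs
    (fun t' h1 h2 => by linarith [hT t' (hsT.trans h1) h2.ge]) ht

lemma cubic_strictAntiOn : StrictAntiOn (fun v : ℝ => 3 * v - v ^ 3) (Set.Ici 1) := by
  intro v hv w hw hvw
  simp only [Set.mem_Ici] at hv hw
  have : 3 < v ^ 2 + v * w + w ^ 2 := by nlinarith
  simp only
  nlinarith [mul_pos (sub_pos.2 hvw) (sub_pos.2 this)]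

lemma cubic_add_const_flow_neg {ε : ℝ} {u g : ℝ → ℝ}
    (h : ∀ t, ε * deriv u t = 3 * u t - u t ^ 3 + g t) (t : ℝ) :
    ε * deriv (-u) t = 3 * (-u) t - (-u) t ^ 3 + (-g) t := by
  rw [deriv.neg]
  simp only [Pi.neg_apply]
  linear_combination -h t

/-- Solutions of the asymptotically autonomous equation `ε u' = 3 u - u³ + g`, `g → G`, converge to
the upper equilibrium when they are eventually kept away from the other equilibria. -/
lemma tendsto_upper_equilibrium {ε : ℝ} (hε : 0 < ε) {u g : ℝ → ℝ} (hu : Differentiable ℝ u)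
    (h : ∀ t, ε * deriv u t = 3 * u t - u t ^ 3 + g t) {G p κ₀ : ℝ}
    (hg : Tendsto g atTop (nhds G)) (hp : 1 < p) (hroot : 3 * p - p ^ 3 + G = 0) (hκ₀ : 0 < κ₀)
    (hlow : ∀ᶠ t in atTop, 1 ≤ u t ∨ κ₀ ≤ 3 * u t - u t ^ 3 + G) :
    Tendsto u atTop (nhds p) := by
  have hanti := cubic_strictAntiOn
  refine tendsto_order.2 ⟨fun k hk => ?_, fun k hk => ?_⟩
  · obtain ⟨q, hq1, hkq, hqp⟩ : ∃ q, 1 < q ∧ k < q ∧ q < p := by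
      obtain ⟨q, hq, hqp⟩ := exists_between (max_lt hp hk)
      exact ⟨q, (le_max_left _ _).trans_lt hq, (le_max_right _ _).trans_lt hq, hqp⟩
    have hq := hanti hq1.le hp.le hqp
    simp only at hq
    obtain ⟨κ, hκ, hκm⟩ : ∃ κ, 0 < κ ∧ κ < min κ₀ (3 * q - q ^ 3 + G) :=
      exists_between (lt_min hκ₀ (by linarith))
    have hκ1 := hκm.trans_le (min_le_left _ _)
    have hκ2 := hκm.trans_le (min_le_right _ _)
    have hev : ∀ᶠ t in atTop, (-u) t ≤ -q := by
      refine eventually_le_of_deriv_le_neg hu.neg (κ := κ / 2 / ε) (by positivity) ?_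
      filter_upwards [hlow, hg.eventually_const_lt (show G - κ / 2 < G by linarith)]
        with t ht1 ht2 ht3
      simp only [Pi.neg_apply, neg_le_neg_iff] at ht3
      rw [deriv.neg, neg_le_neg_iff, div_le_iff₀' hε, h t]
      rcases ht1 with ht1 | ht1
      · have := hanti.antitoneOn ht1 hq1.le ht3
        linarith
      · linarith
    filter_upwards [hev] with t ht
    simp only [Pi.neg_apply, neg_le_neg_iff] at ht
    linarith
  · obtain ⟨q, hpq, hqk⟩ := exists_between hk
    have hq := hanti hp.le (hp.trans hpq).le hpq
    simp only at hq
    obtain ⟨κ, hκ, hκm⟩ : ∃ κ, 0 < κ ∧ κ < -(3 * q - q ^ 3 + G) :=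
      exists_between (by linarith)
    have hev : ∀ᶠ t in atTop, u t ≤ q := by
      refine eventually_le_of_deriv_le_neg hu (κ := κ / 2 / ε) (by positivity) ?_
      filter_upwards [hg.eventually_lt_const (show G < G + κ / 2 by linarith)] with t ht2 ht3
      rw [← neg_div, le_div_iff₀' hε, h t]
      have := hanti.antitoneOn (hp.trans hpq).le ((hp.trans hpq).le.trans ht3) ht3
      linarith
    filter_upwards [hev] with t ht
    linarith

lemma tendsto_tanh_atTop : Tendsto Real.tanh atTop (nhds 1) := by
  have heq : ∀ t : ℝ, 1 - 2 / (Real.exp (2 * t) + 1) = Real.tanh t := by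
    intro t
    rw [Real.tanh_eq_sinh_div_cosh, Real.sinh_eq, Real.cosh_eq, two_mul, Real.exp_add,
      Real.exp_neg]
    have := Real.exp_pos t
    field_simp
    ring
  have hden : Tendsto (fun t : ℝ => Real.exp (2 * t) + 1) atTop atTop :=
    tendsto_atTop_add_const_right _ _
      (Real.tendsto_exp_atTop.comp (tendsto_id.const_mul_atTop two_pos))
  simpa [heq] using (hden.const_div_atTop (2 : ℝ)).const_sub 1

lemma exists_last_le {x : ℝ → ℝ} (hx : Continuous x) {d l p : ℝ} (hl : Tendsto x atBot (nhds l))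
    (hld : l < d) (hp : Tendsto x atTop (nhds p)) (hdp : d < p) :
    ∃ s, x s = d ∧ ∀ t, s ≤ t → d ≤ x t := by
  obtain ⟨T, hT⟩ := eventually_atTop.1 (hp.eventually_const_lt hdp)
  have hne : {t | x t ≤ d}.Nonempty := (hl.eventually_lt_const hld).exists.imp fun _ h => h.le
  have hbdd : BddAbove {t | x t ≤ d} := ⟨T, fun t ht => by
    by_contra! hlt
    exact absurd (hT t hlt.le) (not_lt.2 ht)⟩
  have hmem := (isClosed_le hx continuous_const).csSup_mem hne hbdd
  have hgt : ∀ t, sSup {t | x t ≤ d} < t → d < x t := fun t ht => by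
    by_contra! hle
    exact absurd (le_csSup hbdd hle) (not_le.2 ht)
  have hge : d ≤ x (sSup {t | x t ≤ d}) :=
    ge_of_tendsto (hx.continuousWithinAt (s := Set.Ioi _))
      (eventually_mem_nhdsWithin.mono fun t ht => (hgt t ht).le)
  have heq : x (sSup {t | x t ≤ d}) = d := le_antisymm hmem hge
  refine ⟨_, heq, fun t ht => ?_⟩
  rcases ht.eq_or_lt with rfl | ht
  · exact hge
  · exact (hgt t ht).le

/-- Fast dynamics tip to the upper equilibrium under a forcing that overshoots the fold and
afterwards stays above the opposite fold. -/
lemma exists_forall_tendsto_upper {g : ℝ → ℝ} {G p l A s τ δ : ℝ} (hA : ∀ t, A ≤ g t)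
    (hτ : 0 < τ) (hδ : 0 < δ) (hover : ∀ t, s ≤ t → t ≤ s + τ → 2 + δ < g t)
    (hafter : ∀ t, s ≤ t → -2 < g t) (hg : Tendsto g atTop (nhds G)) (hp : 1 < p)
    (hroot : 3 * p - p ^ 3 + G = 0) {y : ℝ → ℝ → ℝ}
    (hdy : ∀ ε, 0 < ε → Differentiable ℝ (y ε))
    (hy : ∀ ε, 0 < ε → ∀ t, ε * deriv (y ε) t = 3 * y ε t - y ε t ^ 3 + g t)
    (hl : ∀ ε, 0 < ε → Tendsto (y ε) atBot (nhds l)) :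
    ∃ ε₀, 0 < ε₀ ∧ ∀ ε, 0 < ε → ε < ε₀ → Tendsto (y ε) atTop (nhds p) := by
  obtain ⟨K, hK2, hKl, hKA⟩ : ∃ K : ℝ, 2 ≤ K ∧ -l < K ∧ -A < K :=
    ⟨max 2 (max (-l) (-A) + 1), le_max_left _ _,
      ((le_max_left _ _).trans_lt (lt_add_one _)).trans_le (le_max_right _ _),
      ((le_max_right _ _).trans_lt (lt_add_one _)).trans_le (le_max_right _ _)⟩
  refine ⟨δ * τ / (K + 1), by positivity, fun ε hε hlt => ?_⟩
  have hlow : -(y ε s) ≤ K := by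
    refine le_of_tendsto_atBot_of_deriv_neg_of_eq (hdy ε hε).neg (hl ε hε).neg hKl
      fun t _ ht => ?_
    simp only [Pi.neg_apply] at ht
    have hyt : y ε t = -K := by linarith
    have hode := hy ε hε t
    rw [hyt] at hode
    have : 0 < ε * deriv (y ε) t := by
      rw [hode]
      nlinarith [hA t, mul_nonneg (sub_nonneg.2 hK2) (sq_nonneg K)]
    rw [deriv.neg]
    linarith [pos_of_mul_pos_right this hε.le]
  obtain ⟨s', hs', hys'⟩ : ∃ s', s ≤ s' ∧ 1 ≤ y ε s' := by
    by_contra! hcon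
    have hle := le_affine (hdy ε hε).neg (s := s) (e := s + τ) (m := -(δ / ε)) hlow
      (fun t h1 h2 _ => ?_) (t := s + τ) (by linarith) le_rfl
    · have h1 := hcon (s + τ) (by linarith)
      rw [lt_div_iff₀ (by linarith), mul_comm, ← lt_div_iff₀ hε] at hlt
      have : -(δ / ε) * (s + τ - s) = -(δ * τ / ε) := by ring
      simp only [Pi.neg_apply] at hle
      linarith
    · rw [deriv.neg, neg_lt_neg_iff, div_lt_iff₀' hε, hy ε hε t]
      have h3 := hcon t h1
      have h4 := hover t h1 h2.le
      nlinarith [mul_nonneg (show 0 ≤ 2 - y ε t by linarith) (sq_nonneg (1 + y ε t))]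
  refine tendsto_upper_equilibrium hε (hdy ε hε) (hy ε hε) hg hp hroot one_pos ?_
  filter_upwards [eventually_ge_atTop s'] with t ht
  left
  have := le_of_deriv_neg_of_eq (hdy ε hε).neg (s := s') (k := -1) (neg_le_neg hys')
    (fun t h1 h2 => ?_) ht
  · simpa using this
  · simp only [Pi.neg_apply, neg_inj] at h2
    have hode := hy ε hε t
    rw [h2] at hode
    have : 0 < ε * deriv (y ε) t := by
      rw [hode]
      linarith [hafter t (hs'.trans h1)]
    rw [deriv.neg]
    linarith [pos_of_mul_pos_right this hε.le]

/-- Slow dynamics track the lower equilibrium if the forcing is bounded above and is below the fold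
in both the distant past and the distant future. -/
lemma exists_forall_tendsto_lower {g : ℝ → ℝ} {G₀ G p l B : ℝ} (hB : ∀ t, g t ≤ B)
    (hg₀ : Tendsto g atBot (nhds G₀)) (hG₀ : G₀ < 2)
    (hg : Tendsto g atTop (nhds G)) (hG : G < 2) (hp : p < -1)
    (hroot : 3 * p - p ^ 3 + G = 0) {y : ℝ → ℝ → ℝ}
    (hdy : ∀ ε, 0 < ε → Differentiable ℝ (y ε))
    (hy : ∀ ε, 0 < ε → ∀ t, ε * deriv (y ε) t = 3 * y ε t - y ε t ^ 3 + g t)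
    (hl : ∀ ε, 0 < ε → Tendsto (y ε) atBot (nhds l)) (hl1 : l < -1) :
    ∃ ε₁, 0 < ε₁ ∧ ∀ ε, ε₁ < ε → Tendsto (y ε) atTop (nhds p) := by
  obtain ⟨m, hGm, hm2⟩ := exists_between (max_lt hG₀ hG)
  have hm0 := (le_max_left _ _).trans_lt hGm
  have hm1 := (le_max_right _ _).trans_lt hGm
  obtain ⟨η, hη, hη1, hηm⟩ : ∃ η : ℝ, 0 < η ∧ η ≤ 1 ∧ -2 + 3 * η + m < 0 :=
    ⟨min 1 ((2 - m) / 6), lt_min one_pos (by linarith), min_le_left _ _, by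
      linarith [min_le_right 1 ((2 - m) / 6)]⟩
  obtain ⟨T₁, hT₁⟩ := eventually_atBot.1 (hg₀.eventually_lt_const hm0)
  obtain ⟨T₂, hT₁₂, hT₂⟩ : ∃ T₂, T₁ ≤ T₂ ∧ ∀ t, T₂ ≤ t → g t < m := by
    obtain ⟨T, hT⟩ := eventually_atTop.1 (hg.eventually_lt_const hm1)
    exact ⟨max T₁ T, le_max_left _ _, fun t ht => hT t ((le_max_right _ _).trans ht)⟩
  obtain ⟨C, hC0, hCB⟩ : ∃ C : ℝ, 0 < C ∧ 2 + B < C :=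
    ⟨max 1 (3 + B), lt_max_of_lt_left one_pos, lt_max_of_lt_right (by linarith)⟩
  have hε₁ : 0 ≤ C * (T₂ - T₁) / η := div_nonneg (mul_nonneg hC0.le (by linarith)) hη.le
  refine ⟨C * (T₂ - T₁) / η + 1, by linarith, fun ε hlt => ?_⟩
  have hε : 0 < ε := by linarith
  have hstart : y ε T₁ ≤ -1 := by
    refine le_of_tendsto_atBot_of_deriv_neg_of_eq (hdy ε hε) (hl ε hε) hl1 fun t h1 h2 => ?_
    have hode := hy ε hε t
    rw [h2] at hode
    have := hT₁ t h1
    exact neg_of_mul_neg_right (a := ε) (by rw [hode]; linarith) hε.le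
  have hsmall : C / ε * (T₂ - T₁) ≤ η := by
    have : C * (T₂ - T₁) / η ≤ ε := by linarith
    rw [div_le_iff₀ hη, mul_comm ε] at this
    rwa [div_mul_eq_mul_div, div_le_iff₀ hε]
  have hend : y ε T₂ ≤ -1 + η := by
    refine (le_affine (hdy ε hε) (e := T₂) (m := C / ε) hstart (fun t h1 h2 h3 => ?_)
      hT₁₂ le_rfl).trans (by linarith)
    have hpos : 0 < C / ε := by positivity
    have hlo : -1 ≤ y ε t := by
      rw [h3]
      linarith [mul_nonneg hpos.le (sub_nonneg.2 h1)]
    have hhi : y ε t ≤ 0 := by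
      rw [h3]
      linarith [mul_le_mul_of_nonneg_left (sub_le_sub_right h2.le T₁) hpos.le]
    rw [lt_div_iff₀' hε, hy ε hε t]
    nlinarith [hB t, mul_nonneg (show 0 ≤ y ε t + 2 by linarith) (sq_nonneg (y ε t - 1))]
  have hη3 : 3 * η ^ 2 - η ^ 3 ≤ 3 * η := by nlinarith [pow_pos hη 3]
  have hstay : ∀ t, T₂ ≤ t → y ε t ≤ -1 + η := fun t ht => by
    refine le_of_deriv_neg_of_eq (hdy ε hε) hend (fun t h1 h2 => ?_) ht
    have hode := hy ε hε t
    rw [h2] at hode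
    have := hT₂ t h1
    exact neg_of_mul_neg_right (a := ε) (by rw [hode]; linarith) hε.le
  have hneg : Tendsto (-(y ε)) atTop (nhds (-p)) := by
    refine tendsto_upper_equilibrium hε (hdy ε hε).neg (cubic_add_const_flow_neg (hy ε hε))
      hg.neg (by linarith) (by linear_combination -hroot)
      (κ₀ := 2 - 3 * η - m) (by linarith) ?_
    filter_upwards [eventually_ge_atTop T₂] with t ht
    simp only [Pi.neg_apply]
    rcases le_total (y ε t) (-1) with h1 | h1
    · exact Or.inl (by linarith)
    · right
      have h2 := hstay t ht
      obtain ⟨w, hw⟩ : ∃ w, y ε t = -1 + w := ⟨y ε t + 1, by ring⟩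
      rw [hw] at h1 h2 ⊢
      nlinarith [mul_nonneg (show 0 ≤ w by linarith) (show 0 ≤ 1 - w by linarith),
        pow_nonneg (show 0 ≤ w by linarith) 3]
  simpa using hneg.neg

/-- Downstream overshoot for localised coupling `M₂(x) = a + b·sech(c(x − d))`:
the effective downstream forcing temporarily overshoots the fold value `2`
(since `a + b > 2`) but returns to `M₊ < 2`. For sufficiently small timescale
separation `ε` the downstream system B-tips to `X_u(M₊)`, while for sufficiently
large `ε` it tracks and converges to `X_l(M₊)`. -/
theorem stmt_18 (lamm lamp : ℝ) (hm : lamm < 2) (hp : 2 < lamp)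
    (r : ℝ) (hr : 0 < r) (a b c d : ℝ) (hb : 0 < b) (hc : 0 < c)
    (Xlm : ℝ) (hXlm : Xlm < -1) (hXlmroot : 3 * Xlm - Xlm ^ 3 + lamm = 0)
    (Xup : ℝ) (hXup : Xup > 1) (hXuproot : 3 * Xup - Xup ^ 3 + lamp = 0)
    (Mm Mp : ℝ)
    (hMm : Mm = a + b / Real.cosh (c * (Xlm - d)))
    (hMp : Mp = a + b / Real.cosh (c * (Xup - d)))
    (hMm2 : Mm < 2) (hMp2 : -2 < Mp ∧ Mp < 2)
    (hd : Xlm < d ∧ d < Xup) (hab : 2 < a + b)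
    (XlMm : ℝ) (hXlMm : XlMm < -1) (hXlMmroot : 3 * XlMm - XlMm ^ 3 + Mm = 0)
    (XuMp : ℝ) (hXuMp : XuMp > 1) (hXuMproot : 3 * XuMp - XuMp ^ 3 + Mp = 0)
    (XlMp : ℝ) (hXlMp : XlMp < -1) (hXlMproot : 3 * XlMp - XlMp ^ 3 + Mp = 0)
    (x : ℝ → ℝ) (y : ℝ → ℝ → ℝ)
    (hdx : Differentiable ℝ x)
    (hodex : ∀ t : ℝ, deriv x t =
      3 * x t - (x t) ^ 3 + (lamm + (lamp - lamm) * (Real.tanh (r * t) + 1) / 2))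
    (hpastx : Tendsto x atBot (nhds Xlm))
    (hdy : ∀ eps : ℝ, 0 < eps → Differentiable ℝ (y eps))
    (hodey : ∀ eps : ℝ, 0 < eps → ∀ t : ℝ,
      eps * deriv (y eps) t =
        3 * y eps t - (y eps t) ^ 3 + (a + b / Real.cosh (c * (x t - d))))
    (hpasty : ∀ eps : ℝ, 0 < eps → Tendsto (y eps) atBot (nhds XlMm)) :
    (∃ eps0 : ℝ, 0 < eps0 ∧ ∀ eps : ℝ, 0 < eps → eps < eps0 →
      Tendsto (y eps) atTop (nhds XuMp)) ∧
    (∃ eps1 : ℝ, 0 < eps1 ∧ ∀ eps : ℝ, eps1 < eps →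
      Tendsto (y eps) atTop (nhds XlMp)) := by
  have hcoupling : Continuous fun v : ℝ => a + b / Real.cosh (c * (v - d)) :=
    continuous_const.add (continuous_const.div
      (Real.continuous_cosh.comp (by fun_prop)) fun v => (Real.cosh_pos _).ne')
  have hxtop : Tendsto x atTop (nhds Xup) := by
    refine tendsto_upper_equilibrium one_pos hdx (fun t => by rw [one_mul]; exact hodex t)
      (G := lamp) ?_ hXup hXuproot (sub_pos.2 hp) (Eventually.of_forall fun t => ?_)
    · have h := tendsto_tanh_atTop.comp (tendsto_id.const_mul_atTop hr)
      have h2 := (((h.add_const 1).const_mul (lamp - lamm)).div_const 2).const_add lamm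
      convert h2 using 2
      · simp
      · ring
    · rcases le_total 1 (x t) with h | h
      · exact Or.inl h
      · right
        nlinarith [mul_nonneg (show 0 ≤ 2 - x t by linarith) (sq_nonneg (1 + x t))]
  have hxle : ∀ t, x t ≤ Xup := fun T => by
    refine le_of_tendsto_atBot_of_deriv_neg_of_eq hdx hpastx (by linarith) fun t _ ht => ?_
    rw [hodex t, ht]
    nlinarith [Real.tanh_lt_one (r * t)]
  obtain ⟨s, hs, hds⟩ := exists_last_le hdx.continuous hpastx hd.1 hxtop hd.2
  have hgcont := hcoupling.comp hdx.continuous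
  have hgtop : Tendsto (fun t => a + b / Real.cosh (c * (x t - d))) atTop (nhds Mp) :=
    hMp ▸ (hcoupling.tendsto Xup).comp hxtop
  have hgbot : Tendsto (fun t => a + b / Real.cosh (c * (x t - d))) atBot (nhds Mm) :=
    hMm ▸ (hcoupling.tendsto Xlm).comp hpastx
  constructor
  · obtain ⟨τ, hτ, hover⟩ : ∃ τ, 0 < τ ∧ ∀ t, s ≤ t → t ≤ s + τ →
        2 + (a + b - 2) / 2 < a + b / Real.cosh (c * (x t - d)) := by
      have hlt : 2 + (a + b - 2) / 2 < a + b / Real.cosh (c * (x s - d)) := by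
        rw [hs]
        simp
        linarith
      obtain ⟨ρ, hρ, h⟩ := Metric.eventually_nhds_iff.1
        ((hgcont.tendsto s).eventually_const_lt hlt)
      refine ⟨ρ / 2, by linarith, fun t h1 h2 => h ?_⟩
      rw [Real.dist_eq, abs_lt]
      constructor <;> linarith
    refine exists_forall_tendsto_upper (A := a) (δ := (a + b - 2) / 2)
      (fun t => le_add_of_nonneg_right (by positivity))
      hτ (by linarith) hover (fun t ht => ?_) hgtop hXuMp hXuMproot hdy hodey hpasty
    refine hMp2.1.trans_le ?_
    rw [hMp]
    gcongr
    rw [Real.cosh_le_cosh, abs_of_nonneg (mul_nonneg hc.le (sub_nonneg.2 (hds t ht))),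
      abs_of_nonneg (mul_nonneg hc.le (sub_nonneg.2 hd.2.le))]
    gcongr
    exact hxle t
  · exact exists_forall_tendsto_lower (B := a + b)
      (fun t => add_le_add_right (div_le_self hb.le (Real.one_le_cosh _)) a)
      hgbot hMm2 hgtop hMp2.2 hXlMp hXlMproot hdy hodey hpasty hXlMm
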